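/- arXiv:1806.06325 — 2 statements merged into one kernel-verified Lean document; each statement's English description precedes it below -/
import Mathlib

section
/- Let l ≥ 0 and −l ≤ m ≤ l be integers, with the convention that Y_{l'm'} = 0 whenever l' < 0 or |m'| > l'. Then for all θ ∈ [0,π] and φ ∈ [0,2π), sin θ · e^{iφ} · Y_{lm}(θ,φ) = −√(((l+m+1)(l+m+2))/((2l+1)(2l+3)))·Y_{l+1,m+1}(θ,φ) + √(((l−m)(l−m−1))/((2l−1)(2l+1)))·Y_{l−1,m+1}(θ,φ). -/
open scoped Real
open Complex

noncomputable section

/-- Legendre polynomial `P_l` via Rodrigues' formula. -/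
def legendreP (l : ℕ) (x : ℝ) : ℝ :=
  (1 / (2 ^ l * (Nat.factorial l : ℝ))) * iteratedDeriv l (fun y => (y ^ 2 - 1) ^ l) x

/-- Associated Legendre function `P_l^m` for `0 ≤ m ≤ l`. -/
def assocLegendreNat (l m : ℕ) (x : ℝ) : ℝ :=
  (-1 : ℝ) ^ m * (Real.sqrt (1 - x ^ 2)) ^ m * iteratedDeriv m (legendreP l) x

/-- Associated Legendre function `P_l^m` for integer `m`
    (negative `m` via `P_l^{-m} = (-1)^m ((l-m)!/(l+m)!) P_l^m`). -/
def assocLegendre (l : ℕ) (m : ℤ) (x : ℝ) : ℝ :=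
  if 0 ≤ m then assocLegendreNat l m.toNat x
  else
    (-1 : ℝ) ^ m.natAbs *
      ((Nat.factorial (l - m.natAbs) : ℝ) / (Nat.factorial (l + m.natAbs) : ℝ)) *
      assocLegendreNat l m.natAbs x

/-- Spherical harmonic `Y_{lm}(θ,φ)`; by convention it is `0` when `l < 0` or `|m| > l`. -/
def sphHarm (l m : ℤ) (θ φ : ℝ) : ℂ :=
  if 0 ≤ l ∧ |m| ≤ l then
    ((Real.sqrt ((2 * (l : ℝ) + 1) / (4 * Real.pi) *
        ((Nat.factorial (l - m).toNat : ℝ) / (Nat.factorial (l + m).toNat : ℝ))) *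
      assocLegendre l.toNat m (Real.cos θ) : ℝ) : ℂ) *
      Complex.exp (Complex.I * (m : ℂ) * (φ : ℂ))
  else 0

/-- Spin-weighted spherical harmonic `Y_{s,lm}(θ,φ)`;
    by convention it is `0` when `l < |s|` or `|m| > l`. -/
def spinSphHarm (s l m : ℤ) (θ φ : ℝ) : ℂ :=
  if |s| ≤ l ∧ |m| ≤ l then
    ((Real.sqrt ((2 * (l : ℝ) + 1) / (4 * Real.pi) *
          ((Nat.factorial (l + m).toNat : ℝ) * (Nat.factorial (l - m).toNat : ℝ)) /
          ((Nat.factorial (l + s).toNat : ℝ) * (Nat.factorial (l - s).toNat : ℝ))) *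
        Real.sin (θ / 2) ^ (2 * l).toNat : ℝ) : ℂ) *
      Complex.exp (Complex.I * (m : ℂ) * (φ : ℂ)) *
      ∑ r ∈ Finset.Icc (0 : ℤ) (l - s),
        if 0 ≤ r + s - m ∧ r + s - m ≤ l + s then
          ((((l - s).toNat.choose r.toNat : ℝ) * ((l + s).toNat.choose (r + s - m).toNat : ℝ) : ℝ) : ℂ) *
            (-1 : ℂ) ^ (l - r - s) * ((((Real.tan (θ / 2))⁻¹ : ℝ) ^ (2 * r + s - m) : ℝ) : ℂ)
        else 0
  else 0

/-- Integral of a function over the sphere: `∫ f dΩ = ∫₀^{2π} ∫₀^π f(θ,φ) sin θ dθ dφ`. -/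
def sphereIntegral (f : ℝ → ℝ → ℂ) : ℂ :=
  ∫ φ in (0 : ℝ)..(2 * Real.pi), ∫ θ in (0 : ℝ)..Real.pi, f θ φ * ((Real.sin θ : ℝ) : ℂ)

/-- The spin-raising operator `ð` acting on a function of spin weight `s`:
    `ð η = -(sin θ)^s (∂_θ + (i / sin θ) ∂_φ) ((sin θ)^{-s} η)`. -/
def eth (s : ℤ) (η : ℝ → ℝ → ℂ) : ℝ → ℝ → ℂ := fun θ φ =>
  -(((Real.sin θ : ℝ) : ℂ) ^ s) *
    (deriv (fun t => (((Real.sin t : ℝ) : ℂ) ^ (-s)) * η t φ) θ +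
      (Complex.I / ((Real.sin θ : ℝ) : ℂ)) *
        deriv (fun p => (((Real.sin θ : ℝ) : ℂ) ^ (-s)) * η θ p) φ)

/-- The spin-lowering operator `ð̄` acting on a function of spin weight `s`:
    `ð̄ η = -(sin θ)^{-s} (∂_θ - (i / sin θ) ∂_φ) ((sin θ)^s η)`. -/
def ethBar (s : ℤ) (η : ℝ → ℝ → ℂ) : ℝ → ℝ → ℂ := fun θ φ =>
  -(((Real.sin θ : ℝ) : ℂ) ^ (-s)) *
    (deriv (fun t => (((Real.sin t : ℝ) : ℂ) ^ s) * η t φ) θ -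
      (Complex.I / ((Real.sin θ : ℝ) : ℂ)) *
        deriv (fun p => (((Real.sin θ : ℝ) : ℂ) ^ s) * η θ p) φ)

end

noncomputable section

open Polynomial in
/-- The `k`-th derivative of `(X ^ 2 - 1) ^ l`. -/
def rodriguesDeriv (l k : ℕ) : ℝ[X] :=
  derivative^[k] ((X ^ 2 - 1) ^ l)

/-- The `k`-th derivative of the Legendre polynomial `P_l` at `x`. -/
def legendreDeriv (l k : ℕ) (x : ℝ) : ℝ :=
  (1 / (2 ^ l * (Nat.factorial l : ℝ))) * (rodriguesDeriv l (l + k)).eval x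

theorem iteratedDeriv_polynomial_eval (p : Polynomial ℝ) (k : ℕ) :
    iteratedDeriv k (fun x => p.eval x) =
      fun x => (Polynomial.derivative^[k] p).eval x := by
  induction k with
  | zero => simp
  | succ k ih =>
    rw [iteratedDeriv_succ, ih, Function.iterate_succ_apply']
    funext x
    exact Polynomial.deriv _

theorem iteratedDeriv_legendreP (l k : ℕ) (x : ℝ) :
    iteratedDeriv k (legendreP l) x = legendreDeriv l k x := by
  have h : legendreP l = fun x =>
      (1 / (2 ^ l * (Nat.factorial l : ℝ))) * (rodriguesDeriv l l).eval x := by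
    funext x
    have := congrFun (iteratedDeriv_polynomial_eval ((Polynomial.X ^ 2 - 1) ^ l) l) x
    simp only [Polynomial.eval_pow, Polynomial.eval_sub, Polynomial.eval_X,
      Polynomial.eval_one] at this
    rw [legendreP, this, rodriguesDeriv]
  rw [h, iteratedDeriv_const_mul_field, iteratedDeriv_polynomial_eval, legendreDeriv,
    rodriguesDeriv, rodriguesDeriv, ← Function.iterate_add_apply, add_comm k l]

open Polynomial in
theorem rodriguesDeriv_succ_succ (l k : ℕ) :
    rodriguesDeriv (l + 1) (k + 2) =
      C (2 * ((l : ℝ) + 1)) * (X * rodriguesDeriv l (k + 1) +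
        C ((k : ℝ) + 1) * rodriguesDeriv l k) := by
  have h : derivative ((X ^ 2 - 1 : ℝ[X]) ^ (l + 1)) =
      C (2 * ((l : ℝ) + 1)) * ((X ^ 2 - 1) ^ l * X) := by
    simp [derivative_pow, map_ofNat C]
    ring
  rw [rodriguesDeriv, Function.iterate_succ_apply, h, iterate_derivative_C_mul,
    iterate_derivative_mul_X]
  simp only [rodriguesDeriv, map_add, map_natCast, map_one, nsmul_eq_mul, Nat.add_sub_cancel,
    Nat.cast_add, Nat.cast_one]
  ring

open Polynomial in
theorem rodriguesDeriv_add_two (l k : ℕ) :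
    rodriguesDeriv (l + 2) (k + 2) =
      C (2 * ((l : ℝ) + 2)) * (C (2 * (l : ℝ) + 3) * rodriguesDeriv (l + 1) k +
        C (2 * ((l : ℝ) + 1)) * rodriguesDeriv l k) := by
  have h : derivative (derivative ((X ^ 2 - 1 : ℝ[X]) ^ (l + 2))) =
      C (2 * ((l : ℝ) + 2)) * (C (2 * (l : ℝ) + 3) * (X ^ 2 - 1) ^ (l + 1) +
        C (2 * ((l : ℝ) + 1)) * (X ^ 2 - 1) ^ l) := by
    simp [derivative_pow, map_ofNat C]
    ring
  rw [rodriguesDeriv, Function.iterate_succ_apply, Function.iterate_succ_apply, h,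
    iterate_derivative_C_mul, iterate_map_add, iterate_derivative_C_mul,
    iterate_derivative_C_mul]
  rfl

open Polynomial in
theorem sq_sub_one_mul_rodriguesDeriv (l k : ℕ) :
    (X ^ 2 - 1) * rodriguesDeriv l (k + 2) =
      C (2 * ((l : ℝ) - k - 1)) * (X * rodriguesDeriv l (k + 1)) +
        C (((k : ℝ) + 1) * (2 * l - k)) * rodriguesDeriv l k := by
  have h : derivative ((X ^ 2 - 1 : ℝ[X]) ^ l) * X * X - derivative ((X ^ 2 - 1 : ℝ[X]) ^ l) =
      C (2 * (l : ℝ)) * ((X ^ 2 - 1) ^ l * X) := by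
    cases l with
    | zero => simp
    | succ l =>
      simp [derivative_pow, map_ofNat C]
      ring
  have h' := congrArg (fun p => derivative^[k + 1] p) h
  simp only [iterate_derivative_sub, iterate_derivative_mul_X, iterate_derivative_C_mul,
    Nat.add_sub_cancel, nsmul_eq_mul] at h'
  simp only [← Function.iterate_succ_apply] at h'
  simp only [rodriguesDeriv]
  simp only [map_mul, map_sub, map_add, map_one, map_natCast, Nat.cast_add, Nat.cast_one,
    Nat.succ_eq_add_one, map_ofNat, add_assoc, Nat.reduceAdd] at h' ⊢
  have hk : (k : ℝ[X]) * rodriguesDeriv l (k - 1 + 1) = k * rodriguesDeriv l k := by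
    cases k <;> simp
  simp only [rodriguesDeriv] at hk
  linear_combination h' - (k + 1) * hk

theorem legendreDeriv_zero_zero (x : ℝ) : legendreDeriv 0 0 x = 1 := by
  simp [legendreDeriv, rodriguesDeriv]

theorem legendreDeriv_one_one (x : ℝ) : legendreDeriv 1 1 x = 1 := by
  norm_num [legendreDeriv, rodriguesDeriv]

/-- `(2l+1) P_l^{(k)} = P_{l+1}^{(k+1)} - P_{l-1}^{(k+1)}`. -/
theorem legendreDeriv_sub (n k : ℕ) (x : ℝ) :
    (2 * (n : ℝ) + 3) * legendreDeriv (n + 1) k x =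
      legendreDeriv (n + 2) (k + 1) x - legendreDeriv n (k + 1) x := by
  have h := congrArg (Polynomial.eval x) (rodriguesDeriv_add_two n (n + 1 + k))
  have hf : (Nat.factorial n : ℝ) ≠ 0 := by positivity
  simp only [Polynomial.eval_mul, Polynomial.eval_add, Polynomial.eval_C] at h
  have f1 : (Nat.factorial (n + 1) : ℝ) = (n + 1) * Nat.factorial n := by
    exact_mod_cast Nat.factorial_succ n
  have f2 : (Nat.factorial (n + 2) : ℝ) = (n + 2) * ((n + 1) * Nat.factorial n) := by
    rw [← f1]
    exact_mod_cast Nat.factorial_succ (n + 1)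
  rw [legendreDeriv, legendreDeriv, legendreDeriv,
    show n + 2 + (k + 1) = n + 1 + k + 2 by ring, h, show n + (k + 1) = n + 1 + k by ring,
    f1, f2]
  field_simp
  ring

/-- Lowering the order of the derivative:
`(2l+1) (x² - 1) P_l^{(k+1)} = (l-k)(l-k+1) P_{l+1}^{(k)} - (l+k)(l+k+1) P_{l-1}^{(k)}`. -/
theorem sq_sub_one_mul_legendreDeriv (n k : ℕ) (x : ℝ) :
    (2 * (n : ℝ) + 3) * (x ^ 2 - 1) * legendreDeriv (n + 1) (k + 1) x =
      ((n : ℝ) + 1 - k) * (n + 2 - k) * legendreDeriv (n + 2) k x -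
        ((n : ℝ) + 1 + k) * (n + 2 + k) * legendreDeriv n k x := by
  have hA := congrArg (Polynomial.eval x) (rodriguesDeriv_succ_succ (n + 1) (n + k))
  have hB := congrArg (Polynomial.eval x) (sq_sub_one_mul_rodriguesDeriv (n + 1) (n + k))
  have hC := congrArg (Polynomial.eval x) (rodriguesDeriv_add_two n (n + k))
  have hf : (Nat.factorial n : ℝ) ≠ 0 := by positivity
  simp only [Polynomial.eval_mul, Polynomial.eval_add, Polynomial.eval_sub, Polynomial.eval_pow,
    Polynomial.eval_C, Polynomial.eval_X, Polynomial.eval_one] at hA hB hC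
  have f1 : (Nat.factorial (n + 1) : ℝ) = (n + 1) * Nat.factorial n := by
    exact_mod_cast Nat.factorial_succ n
  have f2 : (Nat.factorial (n + 2) : ℝ) = (n + 2) * ((n + 1) * Nat.factorial n) := by
    rw [← f1]
    exact_mod_cast Nat.factorial_succ (n + 1)
  rw [legendreDeriv, legendreDeriv, legendreDeriv,
    show n + 1 + (k + 1) = n + k + 2 by ring, show n + 2 + k = n + k + 2 by ring,
    f1, f2]
  push_cast at *
  generalize (rodriguesDeriv (n + 1) (n + k)).eval x = E at *
  generalize (rodriguesDeriv (n + 1) (n + k + 1)).eval x = F at *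
  generalize (rodriguesDeriv (n + 1) (n + k + 2)).eval x = G at *
  generalize (rodriguesDeriv (n + 2) (n + k + 2)).eval x = H at *
  generalize (rodriguesDeriv n (n + k)).eval x = K at *
  have e1 : (x ^ 2 - 1) * G = -2 * k * (x * F) + (n + k + 1) * (n + 2 - k) * E := by
    linear_combination hB
  have hn2 : (n : ℝ) + 2 ≠ 0 := by positivity
  have hn1 : (n : ℝ) + 1 ≠ 0 := by positivity
  have e2 : x * F = H / (2 * (n + 2)) - (n + k + 1) * E := by
    field_simp
    linear_combination -hA
  have e3 : (2 * n + 3) * E = H / (2 * (n + 2)) - 2 * (n + 1) * K := by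
    field_simp
    linear_combination -hC
  have key : (2 * n + 3) * ((x ^ 2 - 1) * G) =
      (n + 1 - k) * (n + 2 - k) * (H / (2 * (n + 2))) -
        (n + 1 + k) * (n + 2 + k) * (2 * (n + 1) * K) := by
    linear_combination (2 * n + 3) * e1 - 2 * k * (2 * n + 3) * e2 +
      (n + k + 1) * (n + 2 + k) * e3
  field_simp at key ⊢
  linear_combination 2 ^ (2 * n + 1) * key

theorem legendreDeriv_eq_zero {l k : ℕ} (h : l < k) (x : ℝ) : legendreDeriv l k x = 0 := by
  have hd : ((Polynomial.X ^ 2 - 1 : Polynomial ℝ) ^ l).natDegree < l + k := by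
    have : ((Polynomial.X ^ 2 - 1 : Polynomial ℝ) ^ l).natDegree ≤ l * 2 := by
      compute_degree
    omega
  rw [legendreDeriv, rodriguesDeriv, Polynomial.iterate_derivative_eq_zero hd]
  simp

theorem sphHarm_natCast (l k : ℕ) {θ : ℝ} (hθ : θ ∈ Set.Icc 0 Real.pi) (φ : ℝ) :
    sphHarm l k θ φ =
      ((Real.sqrt ((2 * (l : ℝ) + 1) / (4 * Real.pi) *
          ((Nat.factorial (l - k) : ℝ) / (Nat.factorial (l + k) : ℝ))) *
        ((-1) ^ k * Real.sin θ ^ k * legendreDeriv l k (Real.cos θ)) : ℝ) : ℂ) *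
      Complex.exp (Complex.I * (k : ℂ) * (φ : ℂ)) := by
  rcases lt_or_ge l k with h | h
  · rw [sphHarm, if_neg (by simp only [Nat.abs_cast]; omega), legendreDeriv_eq_zero h]
    simp
  · rw [sphHarm, if_pos (by simp only [Nat.abs_cast]; omega), assocLegendre,
      if_pos (by positivity), assocLegendreNat, Int.toNat_natCast, Int.toNat_natCast,
      iteratedDeriv_legendreP, ← Real.sin_eq_sqrt_one_sub_cos_sq hθ.1 hθ.2,
      show ((l : ℤ) - k).toNat = l - k by omega, show ((l : ℤ) + k).toNat = l + k by omega]
    simp only [Int.cast_natCast]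

theorem sphHarm_neg_natCast {l k : ℕ} (h : k ≤ l) {θ : ℝ} (hθ : θ ∈ Set.Icc 0 Real.pi) (φ : ℝ) :
    sphHarm l (-(k : ℤ)) θ φ =
      ((Real.sqrt ((2 * (l : ℝ) + 1) / (4 * Real.pi) *
          ((Nat.factorial (l - k) : ℝ) / (Nat.factorial (l + k) : ℝ))) *
        (Real.sin θ ^ k * legendreDeriv l k (Real.cos θ)) : ℝ) : ℂ) *
      Complex.exp (Complex.I * (-(k : ℂ)) * (φ : ℂ)) := by
  rcases Nat.eq_zero_or_pos k with rfl | hk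
  · simpa using sphHarm_natCast l 0 hθ φ
  · have hs : Real.sqrt ((2 * (l : ℝ) + 1) / (4 * Real.pi) *
          ((Nat.factorial (l + k) : ℝ) / (Nat.factorial (l - k) : ℝ))) *
        ((Nat.factorial (l - k) : ℝ) / (Nat.factorial (l + k) : ℝ)) =
        Real.sqrt ((2 * (l : ℝ) + 1) / (4 * Real.pi) *
          ((Nat.factorial (l - k) : ℝ) / (Nat.factorial (l + k) : ℝ))) := by
      have hr : 0 ≤ (Nat.factorial (l - k) : ℝ) / (Nat.factorial (l + k) : ℝ) := by positivity
      rw [← Real.sqrt_sq hr, ← Real.sqrt_mul (by positivity), Real.sqrt_sq hr]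
      congr 1
      field_simp
    have h1 : ((-1 : ℝ) ^ k) * (-1) ^ k = 1 := by
      rw [← mul_pow]
      norm_num
    rw [sphHarm, if_pos (by simp only [abs_neg, Nat.abs_cast]; omega), assocLegendre,
      if_neg (by omega), assocLegendreNat, Int.toNat_natCast, Int.natAbs_neg, Int.natAbs_natCast,
      iteratedDeriv_legendreP, ← Real.sin_eq_sqrt_one_sub_cos_sq hθ.1 hθ.2,
      show ((l : ℤ) - -k).toNat = l + k by omega, show ((l : ℤ) + -k).toNat = l - k by omega]
    simp only [Int.cast_natCast, Int.cast_neg]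
    congr 2
    rw [← hs]
    linear_combination (Real.sqrt ((2 * (l : ℝ) + 1) / (4 * Real.pi) *
          ((Nat.factorial (l + k) : ℝ) / (Nat.factorial (l - k) : ℝ))) *
        ((Nat.factorial (l - k) : ℝ) / (Nat.factorial (l + k) : ℝ)) * Real.sin θ ^ k *
        legendreDeriv l k (Real.cos θ)) * h1

theorem sqrt_mul_sqrt_eq_mul_sqrt {A B R c : ℝ} (hA : 0 ≤ A) (hc : 0 ≤ c)
    (h : A * B = c ^ 2 * R) : Real.sqrt A * Real.sqrt B = c * Real.sqrt R := by
  rw [← Real.sqrt_mul hA, h, Real.sqrt_mul (sq_nonneg c), Real.sqrt_sq hc]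

theorem sin_exp_mul_sphHarm_natCast (l k : ℕ) (h : k ≤ l) {θ : ℝ}
    (hθ : θ ∈ Set.Icc 0 Real.pi) (φ : ℝ) :
    ((Real.sin θ : ℝ) : ℂ) * Complex.exp (Complex.I * (φ : ℂ)) * sphHarm l k θ φ =
      -((Real.sqrt ((((l : ℝ) + (k : ℝ) + 1) * ((l : ℝ) + (k : ℝ) + 2)) /
          ((2 * (l : ℝ) + 1) * (2 * (l : ℝ) + 3))) : ℝ) : ℂ) * sphHarm (l + 1) (k + 1) θ φ +
      ((Real.sqrt ((((l : ℝ) - (k : ℝ)) * ((l : ℝ) - (k : ℝ) - 1)) /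
          ((2 * (l : ℝ) - 1) * (2 * (l : ℝ) + 1))) : ℝ) : ℂ) * sphHarm (l - 1) (k + 1) θ φ := by
  have hexp : Complex.exp (Complex.I * ((k + 1 : ℕ) : ℂ) * (φ : ℂ)) =
      Complex.exp (Complex.I * (φ : ℂ)) * Complex.exp (Complex.I * (k : ℂ) * (φ : ℂ)) := by
    rw [← Complex.exp_add]
    push_cast
    ring_nf
  have hup : Real.sqrt ((((l : ℝ) + k + 1) * ((l : ℝ) + k + 2)) /
        ((2 * (l : ℝ) + 1) * (2 * (l : ℝ) + 3))) *
      Real.sqrt ((2 * ((l + 1 : ℕ) : ℝ) + 1) / (4 * Real.pi) *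
        ((Nat.factorial (l + 1 - (k + 1)) : ℝ) / (Nat.factorial (l + 1 + (k + 1)) : ℝ))) =
      (1 / (2 * (l : ℝ) + 1)) * Real.sqrt ((2 * (l : ℝ) + 1) / (4 * Real.pi) *
        ((Nat.factorial (l - k) : ℝ) / (Nat.factorial (l + k) : ℝ))) := by
    apply sqrt_mul_sqrt_eq_mul_sqrt (by positivity) (by positivity)
    rw [Nat.add_sub_add_right, show l + 1 + (k + 1) = l + k + 1 + 1 by ring,
      Nat.factorial_succ, Nat.factorial_succ]
    push_cast
    field_simp
    ring
  have hpow : ((-1 : ℝ)) ^ (k + 1) * Real.sin θ ^ (k + 1) =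
      -(Real.sin θ * ((-1) ^ k * Real.sin θ ^ k)) := by ring
  have e1 := sphHarm_natCast (l + 1) (k + 1) hθ φ
  rw [Nat.cast_add, Nat.cast_add, Nat.cast_one] at e1
  rw [sphHarm_natCast l k hθ φ, e1, hexp, hpow]
  rcases l with _ | n
  · obtain rfl : k = 0 := by omega
    rw [sphHarm, if_neg (by simp)]
    simp only [legendreDeriv_zero_zero, zero_add, legendreDeriv_one_one] at hup ⊢
    have hup' := congrArg (fun t : ℝ => (t : ℂ)) hup
    push_cast at hup' ⊢
    linear_combination -(Complex.sin θ * Complex.exp (Complex.I * φ) *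
      Complex.exp (Complex.I * 0 * φ)) * hup'
  · have e2 := sphHarm_natCast n (k + 1) hθ φ
    rw [Nat.cast_add, Nat.cast_one] at e2
    rw [show ((n + 1 : ℕ) : ℤ) - 1 = n by push_cast; ring, e2, hexp, hpow]
    have hdown : Real.sqrt (((((n + 1 : ℕ) : ℝ) - k) * (((n + 1 : ℕ) : ℝ) - k - 1)) /
          ((2 * ((n + 1 : ℕ) : ℝ) - 1) * (2 * ((n + 1 : ℕ) : ℝ) + 1))) *
        Real.sqrt ((2 * (n : ℝ) + 1) / (4 * Real.pi) *
          ((Nat.factorial (n - (k + 1)) : ℝ) / (Nat.factorial (n + (k + 1)) : ℝ))) *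
        legendreDeriv n (k + 1) (Real.cos θ) =
        (1 / (2 * ((n + 1 : ℕ) : ℝ) + 1)) *
          Real.sqrt ((2 * ((n + 1 : ℕ) : ℝ) + 1) / (4 * Real.pi) *
          ((Nat.factorial (n + 1 - k) : ℝ) / (Nat.factorial (n + 1 + k) : ℝ))) *
        legendreDeriv n (k + 1) (Real.cos θ) := by
      rcases lt_or_ge n (k + 1) with hn | hn
      · simp [legendreDeriv_eq_zero hn]
      · obtain ⟨j, rfl⟩ := Nat.exists_eq_add_of_le hn
        congr 1
        push_cast
        have d1 : (0 : ℝ) ≤ k + 1 + j + 1 - k := by linarith [(j.cast_nonneg : (0 : ℝ) ≤ j)]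
        have d2 : (0 : ℝ) ≤ k + 1 + j + 1 - k - 1 := by linarith [(j.cast_nonneg : (0 : ℝ) ≤ j)]
        have d3 : (2 : ℝ) * (k + 1 + j + 1) - 1 = 2 * k + 2 * j + 3 := by ring
        rw [d3]
        apply sqrt_mul_sqrt_eq_mul_sqrt (by positivity) (by positivity)
        rw [show k + 1 + j - (k + 1) = j by omega, show k + 1 + j + 1 - k = j + 1 + 1 by omega,
          show k + 1 + j + (k + 1) = k + 1 + j + 1 + k by ring,
          Nat.factorial_succ (j + 1), Nat.factorial_succ j]
        push_cast
        field_simp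
        ring
    have hrec := legendreDeriv_sub n k (Real.cos θ)
    have hmain : legendreDeriv (n + 1) k (Real.cos θ) =
        (1 / (2 * ((n + 1 : ℕ) : ℝ) + 1)) * (legendreDeriv (n + 2) (k + 1) (Real.cos θ) -
          legendreDeriv n (k + 1) (Real.cos θ)) := by
      rw [← hrec]
      push_cast
      field_simp
      ring
    rw [hmain]
    have hup' := congrArg (fun t : ℝ => (t : ℂ)) hup
    have hdown' := congrArg (fun t : ℝ => (t : ℂ)) hdown
    push_cast at hup' hdown' ⊢
    linear_combination (Complex.sin θ * ((-1) ^ k * Complex.sin θ ^ k) *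
      (Complex.exp (Complex.I * φ) * Complex.exp (Complex.I * k * φ))) *
      (hdown' - (legendreDeriv (n + 1 + 1) (k + 1) (Real.cos θ) : ℂ) * hup')

theorem sin_exp_mul_sphHarm_neg_natCast (n k : ℕ) (h : k ≤ n) {θ : ℝ}
    (hθ : θ ∈ Set.Icc 0 Real.pi) (φ : ℝ) :
    ((Real.sin θ : ℝ) : ℂ) * Complex.exp (Complex.I * (φ : ℂ)) *
        sphHarm ((n + 1 : ℕ) : ℤ) (-((k + 1 : ℕ) : ℤ)) θ φ =
      -((Real.sqrt ((((n : ℝ) + 1 - k) * ((n : ℝ) + 2 - k)) /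
          ((2 * (n : ℝ) + 3) * (2 * (n : ℝ) + 5))) : ℝ) : ℂ) *
        sphHarm ((n + 2 : ℕ) : ℤ) (-(k : ℤ)) θ φ +
      ((Real.sqrt ((((n : ℝ) + 2 + k) * ((n : ℝ) + 1 + k)) /
          ((2 * (n : ℝ) + 1) * (2 * (n : ℝ) + 3))) : ℝ) : ℂ) *
        sphHarm (n : ℤ) (-(k : ℤ)) θ φ := by
  have hexp : Complex.exp (Complex.I * (-(k : ℂ)) * (φ : ℂ)) =
      Complex.exp (Complex.I * (φ : ℂ)) *
        Complex.exp (Complex.I * (-((k + 1 : ℕ) : ℂ)) * (φ : ℂ)) := by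
    rw [← Complex.exp_add]
    push_cast
    ring_nf
  rw [sphHarm_neg_natCast (by omega) hθ, sphHarm_neg_natCast (by omega) hθ,
    sphHarm_neg_natCast h hθ, hexp]
  have hrec := sq_sub_one_mul_legendreDeriv n k (Real.cos θ)
  have hsin : Real.cos θ ^ 2 - 1 = -Real.sin θ ^ 2 := by
    linear_combination Real.sin_sq_add_cos_sq θ
  rw [hsin] at hrec
  obtain ⟨j, rfl⟩ := Nat.exists_eq_add_of_le h
  set N := Real.sqrt ((2 * ((k + j + 1 : ℕ) : ℝ) + 1) / (4 * Real.pi) *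
    ((Nat.factorial (k + j + 1 - (k + 1)) : ℝ) / (Nat.factorial (k + j + 1 + (k + 1)) : ℝ)))
  have hup : Real.sqrt (((((k + j : ℕ) : ℝ) + 1 - k) * (((k + j : ℕ) : ℝ) + 2 - k)) /
        ((2 * ((k + j : ℕ) : ℝ) + 3) * (2 * ((k + j : ℕ) : ℝ) + 5))) *
      Real.sqrt ((2 * ((k + j + 2 : ℕ) : ℝ) + 1) / (4 * Real.pi) *
        ((Nat.factorial (k + j + 2 - k) : ℝ) / (Nat.factorial (k + j + 2 + k) : ℝ))) =
      (((j : ℝ) + 1) * (j + 2) / (2 * ((k + j : ℕ) : ℝ) + 3)) * N := by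
    rw [show (((k + j : ℕ) : ℝ) + 1 - k) = j + 1 by push_cast; ring,
      show (((k + j : ℕ) : ℝ) + 2 - k) = j + 2 by push_cast; ring]
    apply sqrt_mul_sqrt_eq_mul_sqrt (by positivity) (by positivity)
    rw [show k + j + 2 - k = j + 1 + 1 by omega, show k + j + 1 - (k + 1) = j by omega,
      show k + j + 1 + (k + 1) = k + j + 2 + k by ring,
      Nat.factorial_succ (j + 1), Nat.factorial_succ j]
    push_cast
    field_simp
    ring
  have hdown : Real.sqrt (((((k + j : ℕ) : ℝ) + 2 + k) * (((k + j : ℕ) : ℝ) + 1 + k)) /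
        ((2 * ((k + j : ℕ) : ℝ) + 1) * (2 * ((k + j : ℕ) : ℝ) + 3))) *
      Real.sqrt ((2 * ((k + j : ℕ) : ℝ) + 1) / (4 * Real.pi) *
        ((Nat.factorial (k + j - k) : ℝ) / (Nat.factorial (k + j + k) : ℝ))) =
      ((((k + j : ℕ) : ℝ) + 1 + k) * (((k + j : ℕ) : ℝ) + 2 + k) /
        (2 * ((k + j : ℕ) : ℝ) + 3)) * N := by
    apply sqrt_mul_sqrt_eq_mul_sqrt (by positivity) (by positivity)
    rw [show k + j - k = j by omega, show k + j + 1 - (k + 1) = j by omega,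
      show k + j + 1 + (k + 1) = k + j + k + 1 + 1 by ring,
      Nat.factorial_succ (k + j + k + 1), Nat.factorial_succ (k + j + k)]
    push_cast
    field_simp
    ring
  have hmain : Real.sin θ ^ 2 * legendreDeriv (k + j + 1) (k + 1) (Real.cos θ) =
      -(((j : ℝ) + 1) * (j + 2) / (2 * ((k + j : ℕ) : ℝ) + 3)) *
          legendreDeriv (k + j + 2) k (Real.cos θ) +
        ((((k + j : ℕ) : ℝ) + 1 + k) * (((k + j : ℕ) : ℝ) + 2 + k) /
          (2 * ((k + j : ℕ) : ℝ) + 3)) * legendreDeriv (k + j) k (Real.cos θ) := by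
    field_simp
    push_cast at hrec ⊢
    linear_combination -hrec
  have hup' := congrArg (fun t : ℝ => (t : ℂ)) hup
  have hdown' := congrArg (fun t : ℝ => (t : ℂ)) hdown
  have hmain' := congrArg (fun t : ℝ => (t : ℂ)) hmain
  clear_value N
  push_cast at hup' hdown' hmain' ⊢
  linear_combination (Complex.sin θ ^ k *
    (Complex.exp (Complex.I * φ) * Complex.exp (Complex.I * -((k : ℂ) + 1) * φ))) *
    (N * hmain' + (legendreDeriv (k + j + 2) k (Real.cos θ) : ℂ) * hup' -
      (legendreDeriv (k + j) k (Real.cos θ) : ℂ) * hdown')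

end

/-- **Recursion for `sin θ e^{iφ} Y_{lm}`:**
`sin θ e^{iφ} Y_{lm} = -√(((l+m+1)(l+m+2))/((2l+1)(2l+3))) Y_{l+1,m+1}
 + √(((l-m)(l-m-1))/((2l-1)(2l+1))) Y_{l-1,m+1}`,
with the convention that `Y_{l'm'} = 0` when `l' < 0` or `|m'| > l'`. -/
theorem sin_exp_mul_sphHarm
    (l m : ℤ) (hl : 0 ≤ l) (hm : |m| ≤ l) :
    ∀ θ ∈ Set.Icc (0 : ℝ) Real.pi, ∀ φ ∈ Set.Ico (0 : ℝ) (2 * Real.pi),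
      ((Real.sin θ : ℝ) : ℂ) * Complex.exp (Complex.I * (φ : ℂ)) * sphHarm l m θ φ =
        -((Real.sqrt ((((l : ℝ) + (m : ℝ) + 1) * ((l : ℝ) + (m : ℝ) + 2)) /
            ((2 * (l : ℝ) + 1) * (2 * (l : ℝ) + 3))) : ℝ) : ℂ) * sphHarm (l + 1) (m + 1) θ φ +
        ((Real.sqrt ((((l : ℝ) - (m : ℝ)) * ((l : ℝ) - (m : ℝ) - 1)) /
            ((2 * (l : ℝ) - 1) * (2 * (l : ℝ) + 1))) : ℝ) : ℂ) * sphHarm (l - 1) (m + 1) θ φ := by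
  intro θ hθ φ _
  obtain ⟨l, rfl⟩ := Int.eq_ofNat_of_zero_le hl
  rcases le_or_gt 0 m with h0 | h0
  · obtain ⟨k, rfl⟩ := Int.eq_ofNat_of_zero_le h0
    have hk : k ≤ l := by simpa using hm
    simpa only [Int.cast_natCast] using sin_exp_mul_sphHarm_natCast l k hk hθ φ
  · obtain ⟨k, rfl⟩ : ∃ k : ℕ, m = -((k + 1 : ℕ) : ℤ) := ⟨(-m - 1).toNat, by omega⟩
    rw [abs_neg, Nat.abs_cast] at hm
    obtain ⟨n, rfl⟩ : ∃ n, l = n + 1 := ⟨l - 1, by omega⟩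
    rw [sin_exp_mul_sphHarm_neg_natCast n k (by omega) hθ φ]
    have h1 : ((n + 1 : ℕ) : ℤ) + 1 = (n + 2 : ℕ) := by push_cast; ring
    have h2 : ((n + 1 : ℕ) : ℤ) - 1 = n := by push_cast; ring
    have h3 : -((k + 1 : ℕ) : ℤ) + 1 = -k := by push_cast; ring
    rw [h1, h2, h3]
    push_cast
    ring_nf
end

section
/- Let s be an integer and let l, l', m, m' be integers with l ≥ |s|, l' ≥ |s|, |m| ≤ l, |m'| ≤ l'. Then the spin-weighted spherical harmonics are orthonormal on the sphere: ∫ Y_{s,lm} · conj(Y_{s,l'm'}) dΩ = 1 if l = l' and m = m', and = 0 otherwise. In particular (taking s = 0) the ordinary spherical harmonics Y_{lm} are orthonormal. -/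
open scoped Real
open Complex

open Polynomial in
/-- Evaluation of an iterated derivative of `X ^ p * (1 - X) ^ q`. -/
theorem eval_iterate_derivative_X_pow_mul_one_sub_X_pow {a b p q : ℕ} (h : a + b = p + q) (x : ℝ) :
    (b.factorial : ℝ) * (derivative^[a] (X ^ p * (1 - X) ^ q : ℝ[X])).eval x =
      p.factorial * q.factorial * ∑ i ∈ Finset.range (a + 1), ∑ k ∈ Finset.range (b + 1),
        if i + p = a + k then
          (a.choose i : ℝ) * b.choose k * (-1) ^ i * (x ^ k * (1 - x) ^ (b - k)) else 0 := by
  have hcomp : ((1 - X) ^ q : ℝ[X]) = (X ^ q).comp (1 - X) := by simp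
  rw [iterate_derivative_mul, eval_finsetSum, Finset.mul_sum, Finset.mul_sum]
  refine Finset.sum_congr rfl fun i hi => ?_
  have hia : i ≤ a := Nat.lt_succ_iff.mp (Finset.mem_range.mp hi)
  rw [hcomp, iterate_derivative_comp_one_sub_X, iterate_derivative_X_pow_eq_C_mul,
    iterate_derivative_X_pow_eq_C_mul]
  simp only [eval_mul, eval_C, eval_pow, eval_X, eval_natCast, eval_sub, eval_one,
    eval_neg, mul_comp, C_comp, X_pow_comp, nsmul_eq_mul]
  rw [Finset.mul_sum]
  by_cases hk : a ≤ i + p ∧ i ≤ q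
  · obtain ⟨hk₁, hk₂⟩ := hk
    obtain ⟨k, hk⟩ := Nat.exists_eq_add_of_le hk₁
    have hkb : k ≤ b := by omega
    rw [Finset.sum_eq_single k (fun j _ hj => by rw [if_neg (by omega), mul_zero])
      (fun hn => absurd (Finset.mem_range.mpr (Nat.lt_succ_of_le hkb)) hn), if_pos hk]
    rw [show p - (a - i) = k by omega, show q - i = b - k by omega]
    have h₁ : (k.factorial : ℝ) * p.descFactorial (a - i) = p.factorial := by
      have := Nat.factorial_mul_descFactorial (n := p) (k := a - i) (by omega)
      rw [show p - (a - i) = k by omega] at this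
      exact_mod_cast this
    have h₂ : ((b - k).factorial : ℝ) * q.descFactorial i = q.factorial := by
      have := Nat.factorial_mul_descFactorial hk₂
      rw [show q - i = b - k by omega] at this
      exact_mod_cast this
    have h₃ : (b.choose k : ℝ) * k.factorial * (b - k).factorial = b.factorial := by
      exact_mod_cast Nat.choose_mul_factorial_mul_factorial hkb
    rw [← h₁, ← h₂, ← h₃]
    ring
  · rw [Finset.sum_eq_zero fun k hk' => by
      rw [if_neg (by have := Finset.mem_range.mp hk'; omega), mul_zero]]
    rcases not_and_or.mp hk with hk | hk
    · simp [Nat.descFactorial_eq_zero_iff_lt.mpr (show p < a - i by omega)]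
    · simp [Nat.descFactorial_eq_zero_iff_lt.mpr (show q < i by omega)]

open Polynomial in
theorem iterate_derivative_X_pow_mul_one_sub_X_pow_eq_zero {n p q : ℕ} (h : p + q < n) :
    derivative^[n] (X ^ p * (1 - X) ^ q : ℝ[X]) = 0 := by
  apply iterate_derivative_eq_zero
  refine lt_of_le_of_lt ?_ h
  compute_degree

open Polynomial in
theorem eval_iterate_derivative_add_X_pow_mul_one_sub_X_pow (p q : ℕ) (x : ℝ) :
    (derivative^[p + q] (X ^ p * (1 - X) ^ q : ℝ[X])).eval x = (p + q).factorial * (-1) ^ q := by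
  have := eval_iterate_derivative_X_pow_mul_one_sub_X_pow (a := p + q) (b := 0) (add_zero (p + q)) x
  rw [Finset.sum_eq_single q (fun j _ hj => by simp [show j + p ≠ p + q by omega])
    (fun hn => absurd (Finset.mem_range.mpr (by omega)) hn)] at this
  simp only [Nat.factorial_zero, Nat.cast_one, one_mul, zero_add, Finset.range_one,
    Finset.sum_singleton, add_zero, add_comm q p, if_true, Nat.choose_self, pow_zero,
    Nat.sub_zero, mul_one] at this
  rw [this, ← Nat.add_choose_mul_factorial_mul_factorial p q, Nat.add_comm, Nat.choose_symm_add]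
  push_cast
  ring

open Polynomial in
/-- Iterated integration by parts on `[0, 1]` for polynomials whose boundary terms vanish. -/
theorem integral_iterate_derivative_mul {F G : ℝ[X]} (a b : ℕ)
    (h₀ : ∀ i j, i + j + 1 = a + b → (derivative^[i] F * derivative^[j] G).eval 0 = 0)
    (h₁ : ∀ i j, i + j + 1 = a + b → (derivative^[i] F * derivative^[j] G).eval 1 = 0) :
    ∫ t in (0 : ℝ)..1, (derivative^[a] F).eval t * (derivative^[b] G).eval t =
      (-1) ^ b * ∫ t in (0 : ℝ)..1, (derivative^[a + b] F).eval t * G.eval t := by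
  induction b generalizing a with
  | zero => simp
  | succ b ih =>
    have e₀ := h₀ a b (by omega)
    have e₁ := h₁ a b (by omega)
    rw [eval_mul] at e₀ e₁
    have key := intervalIntegral.integral_mul_deriv_eq_deriv_mul (a := 0) (b := 1)
      (u := fun t => (derivative^[a] F).eval t) (v := fun t => (derivative^[b] G).eval t)
      (u' := fun t => (derivative^[a + 1] F).eval t) (v' := fun t => (derivative^[b + 1] G).eval t)
      (fun t _ => by rw [Function.iterate_succ_apply']; exact Polynomial.hasDerivAt _ t)
      (fun t _ => by rw [Function.iterate_succ_apply']; exact Polynomial.hasDerivAt _ t)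
      ((Polynomial.continuous _).intervalIntegrable _ _)
      ((Polynomial.continuous _).intervalIntegrable _ _)
    rw [key, e₀, e₁, ih (a + 1) (fun i j hij => h₀ i j (by omega))
      (fun i j hij => h₁ i j (by omega)), show a + 1 + b = a + (b + 1) by omega, pow_succ]
    ring

open Polynomial in
theorem eval_iterate_derivative_mul_eq_zero {F G : ℝ[X]} {x : ℝ} {m n i j : ℕ}
    (hF : (X - C x) ^ m ∣ F) (hG : (X - C x) ^ n ∣ G) (h : i + j < m + n) :
    (derivative^[i] F * derivative^[j] G).eval x = 0 := by
  have hd := mul_dvd_mul (pow_sub_dvd_iterate_derivative_of_pow_dvd i hF)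
    (pow_sub_dvd_iterate_derivative_of_pow_dvd j hG)
  rw [← pow_add] at hd
  exact dvd_iff_isRoot.mp ((dvd_pow_self _ (by omega)).trans hd)

open Polynomial in
theorem X_sub_C_zero_pow_dvd_X_pow_mul (p q : ℕ) :
    (X - C (0 : ℝ)) ^ p ∣ (X ^ p * (1 - X) ^ q : ℝ[X]) := by simp

open Polynomial in
theorem X_sub_C_one_pow_dvd_mul_one_sub_X_pow (p q : ℕ) :
    (X - C (1 : ℝ)) ^ q ∣ (X ^ p * (1 - X) ^ q : ℝ[X]) := by
  refine Dvd.dvd.mul_left (pow_dvd_pow_of_dvd ⟨-1, ?_⟩ q) _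
  simp

open Polynomial in
theorem integral_pow_mul_one_sub_pow (p q : ℕ) :
    ∫ t in (0 : ℝ)..1, t ^ p * (1 - t) ^ q =
      (p.factorial * q.factorial : ℝ) / (p + q + 1).factorial := by
  have key := integral_iterate_derivative_mul (F := X ^ (p + q) * (1 - X) ^ 0)
    (G := X ^ 0 * (1 - X) ^ q) 0 q
    (fun i j hij => eval_iterate_derivative_mul_eq_zero (X_sub_C_zero_pow_dvd_X_pow_mul _ _)
      (X_sub_C_zero_pow_dvd_X_pow_mul _ _) (by omega))
    (fun i j hij => eval_iterate_derivative_mul_eq_zero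
      (X_sub_C_one_pow_dvd_mul_one_sub_X_pow _ _)
      (X_sub_C_one_pow_dvd_mul_one_sub_X_pow _ _) (by omega))
  have hG (t : ℝ) : (derivative^[q] (X ^ 0 * (1 - X) ^ q : ℝ[X])).eval t =
      q.factorial * (-1) ^ q := by
    simpa using eval_iterate_derivative_add_X_pow_mul_one_sub_X_pow 0 q t
  have hF (t : ℝ) : (derivative^[0 + q] (X ^ (p + q) * (1 - X) ^ 0 : ℝ[X])).eval t =
      (p + q).descFactorial q * t ^ p := by
    rw [pow_zero, mul_one, zero_add, iterate_derivative_X_pow_eq_C_mul]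
    simp
  simp only [hG, hF] at key
  have hdesc : (p.factorial : ℝ) * (p + q).descFactorial q = (p + q).factorial := by
    have := Nat.factorial_mul_descFactorial (Nat.le_add_left q p)
    rw [Nat.add_sub_cancel] at this
    exact_mod_cast this
  simp only [Function.iterate_zero, id, eval_pow, eval_X, eval_sub, eval_one, pow_zero,
    mul_one, one_mul, mul_assoc, intervalIntegral.integral_mul_const,
    intervalIntegral.integral_const_mul, integral_pow] at key
  have hd : ((p + q).descFactorial q : ℝ) ≠ 0 := fun h0 => by
    rw [h0, mul_zero] at hdesc
    exact (Nat.cast_ne_zero.mpr (p + q).factorial_ne_zero) hdesc.symm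
  have hn : ((p : ℝ) + q + 1) ≠ 0 := by positivity
  have hp : (p.factorial : ℝ) ≠ 0 := by positivity
  rw [Nat.factorial_succ, Nat.cast_mul, ← hdesc]
  push_cast at key ⊢
  simp at key
  field_simp at key ⊢
  exact key.symm

/-- The real polynomial in `x = cos (θ / 2)`, `y = sin (θ / 2)` carrying the `θ`-dependence of
`spinSphHarm`, with `a = l - s`, `b = l + s` and `p = l - m`. -/
noncomputable def spinSphHarmPoly (a b p : ℕ) (x y : ℝ) : ℝ :=
  ∑ i ∈ Finset.range (a + 1), ∑ k ∈ Finset.range (b + 1),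
    if i + p = a + k then
      (a.choose i : ℝ) * b.choose k * (-1) ^ (a - i) * (x ^ (i + k) * y ^ ((a - i) + (b - k)))
    else 0

theorem spinSphHarmPoly_swap {a b p q : ℕ} (h : a + b = p + q) (x y : ℝ) :
    spinSphHarmPoly a b p x y = (-1) ^ (p + b) * spinSphHarmPoly b a q x y := by
  unfold spinSphHarmPoly
  rw [Finset.sum_comm, Finset.mul_sum]
  refine Finset.sum_congr rfl fun k hk => ?_
  rw [Finset.mul_sum]
  refine Finset.sum_congr rfl fun i hi => ?_
  have hk' := Finset.mem_range.mp hk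
  have hi' := Finset.mem_range.mp hi
  by_cases hc : i + p = a + k
  · rw [if_pos hc, if_pos (by omega)]
    have hs : (-1 : ℝ) ^ (a - i) = (-1) ^ (p + b) * (-1) ^ (b - k) := by
      rw [← pow_add, show p + b + (b - k) = (a - i) + 2 * b by omega, pow_add, pow_mul]
      simp
    rw [hs, add_comm i k, add_comm (a - i)]
    ring
  · rw [if_neg hc, if_neg (by omega), mul_zero]

theorem pow_mul_pow_mul_spinSphHarmPoly_eq_sum {a b p q : ℕ} (h : a + b = p + q) (x y : ℝ) :
    x ^ p * y ^ b * spinSphHarmPoly a b p x y =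
      (-1) ^ a * (x ^ a * y ^ p) * ∑ i ∈ Finset.range (a + 1), ∑ k ∈ Finset.range (b + 1),
        if i + p = a + k then
          (a.choose i : ℝ) * b.choose k * (-1) ^ i * ((x ^ 2) ^ k * (y ^ 2) ^ (b - k)) else 0 := by
  unfold spinSphHarmPoly
  rw [Finset.mul_sum, Finset.mul_sum]
  refine Finset.sum_congr rfl fun i hi => ?_
  rw [Finset.mul_sum, Finset.mul_sum]
  refine Finset.sum_congr rfl fun k hk => ?_
  have hk' := Finset.mem_range.mp hk
  have hi' := Finset.mem_range.mp hi
  split_ifs with hc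
  · have hs : (-1 : ℝ) ^ (a - i) = (-1) ^ a * (-1) ^ i := by
      rw [← pow_add, show a + i = (a - i) + 2 * i by omega, pow_add, pow_mul]
      simp
    have hx : x ^ p * x ^ (i + k) = x ^ a * (x ^ 2) ^ k := by
      rw [← pow_mul, ← pow_add, ← pow_add]; congr 1; omega
    have hy : y ^ b * y ^ ((a - i) + (b - k)) = y ^ p * (y ^ 2) ^ (b - k) := by
      rw [← pow_mul, ← pow_add, ← pow_add]; congr 1; omega
    rw [hs]
    linear_combination (a.choose i : ℝ) * b.choose k * (-1) ^ a * (-1) ^ i *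
      (hx * y ^ b * y ^ ((a - i) + (b - k)) + hy * (x ^ a * (x ^ 2) ^ k))
  · simp

theorem sum_Icc_zero_intCast {M : Type*} [AddCommMonoid M] (a : ℕ) (f : ℤ → M) :
    ∑ r ∈ Finset.Icc (0 : ℤ) a, f r = ∑ i ∈ Finset.range (a + 1), f i := by
  refine Finset.sum_nbij' Int.toNat (fun i => (i : ℤ)) ?_ ?_ ?_ ?_ ?_ <;>
    simp only [Finset.mem_Icc, Finset.mem_range] <;> intro i hi
  · omega
  · omega
  · omega
  · omega
  · rw [Int.toNat_of_nonneg hi.1]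

theorem spinSphHarm_eq {s l m : ℤ} {a b p q : ℕ} (ha : l - s = a) (hb : l + s = b)
    (hp : l - m = p) (hq : l + m = q) {θ : ℝ} (hθ : θ ∈ Set.Ioo 0 π) (φ : ℝ) :
    spinSphHarm s l m θ φ =
      ((√((a + b + 1) / (4 * π) * (q.factorial * p.factorial) / (b.factorial * a.factorial)) *
        spinSphHarmPoly a b p (Real.cos (θ / 2)) (Real.sin (θ / 2)) : ℝ) : ℂ) *
        cexp (I * m * φ) := by
  have hsin : Real.sin (θ / 2) ≠ 0 :=
    (Real.sin_pos_of_pos_of_lt_pi (by linarith [hθ.1]) (by linarith [hθ.1, hθ.2])).ne'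
  have h2l : (2 * (l : ℝ)) = a + b := by
    have : 2 * l = a + b := by omega
    exact_mod_cast this
  have hsum : Real.sin (θ / 2) ^ (a + b) * (∑ i ∈ Finset.range (a + 1),
      if 0 ≤ (i : ℤ) + s - m ∧ (i : ℤ) + s - m ≤ b then
        (a.choose i * b.choose ((i : ℤ) + s - m).toNat : ℝ) * (-1) ^ (l - i - s) *
          (Real.tan (θ / 2))⁻¹ ^ (2 * (i : ℤ) + s - m)
      else 0) = spinSphHarmPoly a b p (Real.cos (θ / 2)) (Real.sin (θ / 2)) := by
    unfold spinSphHarmPoly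
    rw [Finset.mul_sum]
    refine Finset.sum_congr rfl fun i hi => ?_
    have hi' := Finset.mem_range.mp hi
    split_ifs with hc
    · obtain ⟨k, hk⟩ := Int.eq_ofNat_of_zero_le hc.1
      rw [Finset.sum_eq_single k (fun j _ hj => by rw [if_neg (by omega)])
        (fun hn => absurd (Finset.mem_range.mpr (by omega)) hn), if_pos (by omega), hk,
        show 2 * (i : ℤ) + s - m = ((i + k : ℕ) : ℤ) by push_cast; omega,
        show l - i - s = ((a - i : ℕ) : ℤ) by omega, zpow_natCast, zpow_natCast,
        Int.toNat_natCast, Real.tan_eq_sin_div_cos, inv_div, div_pow,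
        show a + b = (i + k) + ((a - i) + (b - k)) by omega, pow_add (Real.sin (θ / 2))]
      field_simp
    · rw [mul_zero, Finset.sum_eq_zero]
      intro k hk
      have hk' := Finset.mem_range.mp hk
      rw [if_neg (by omega)]
  rw [spinSphHarm, if_pos ⟨by rw [abs_le]; omega, by rw [abs_le]; omega⟩, ← hsum, h2l, ha, hb, hp,
    hq, sum_Icc_zero_intCast]
  simp only [Int.toNat_natCast, show (2 * l).toNat = a + b by omega]
  push_cast
  simp only [apply_ite ((↑) : ℝ → ℂ)]
  push_cast
  ring

theorem integral_cexp_mul_conj (m n : ℤ) :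
    ∫ φ in (0 : ℝ)..2 * π, cexp (I * m * φ) * (starRingEnd ℂ) (cexp (I * n * φ)) =
      if m = n then 2 * (π : ℂ) else 0 := by
  have h (φ : ℝ) : cexp (I * m * φ) * (starRingEnd ℂ) (cexp (I * n * φ)) =
      cexp (((m - n : ℤ) : ℂ) * I * φ) := by
    rw [← exp_conj, ← Complex.exp_add]
    simp
    ring_nf
  simp only [h]
  split_ifs with hmn
  · simp [hmn]
  · have hc : ((m - n : ℤ) : ℂ) * I ≠ 0 :=
      mul_ne_zero (Int.cast_ne_zero.mpr (sub_ne_zero.mpr hmn)) I_ne_zero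
    rw [integral_exp_mul_complex hc]
    rw [show ((m - n : ℤ) : ℂ) * I * ((2 * π : ℝ) : ℂ) = (m - n : ℤ) * (2 * π * I) by
      push_cast; ring, exp_int_mul_two_pi_mul_I]
    simp

open Polynomial in
theorem integral_eval_cos_half_sq_mul_sin (P : ℝ[X]) :
    ∫ θ in (0 : ℝ)..π, P.eval (Real.cos (θ / 2) ^ 2) * Real.sin θ =
      2 * ∫ t in (0 : ℝ)..1, P.eval t := by
  have hd (θ : ℝ) : HasDerivAt (fun θ => Real.cos (θ / 2) ^ 2) (-(1 / 2) * Real.sin θ) θ := by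
    have := (((hasDerivAt_id θ).div_const 2).cos).pow 2
    refine this.congr_deriv ?_
    have h2 := Real.sin_two_mul (θ / 2)
    rw [show 2 * (θ / 2) = θ by ring] at h2
    rw [h2]
    simp
    ring
  have := intervalIntegral.integral_comp_mul_deriv (a := 0) (b := π) (g := fun t => P.eval t)
    (fun θ _ => hd θ) (by fun_prop) (Polynomial.continuous P)
  simp only [Function.comp_def, zero_div, Real.cos_zero, Real.cos_pi_div_two] at this
  rw [one_pow, zero_pow two_ne_zero, intervalIntegral.integral_symm 0 1,
    intervalIntegral.integral_congr (g := fun θ => -(1 / 2) *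
      (P.eval (Real.cos (θ / 2) ^ 2) * Real.sin θ)) (fun θ _ => by ring),
    intervalIntegral.integral_const_mul] at this
  linarith

open Polynomial in
theorem pow_mul_pow_mul_spinSphHarmPoly {a b p q : ℕ} (h : a + b = p + q) {x y : ℝ}
    (hxy : x ^ 2 + y ^ 2 = 1) :
    (p.factorial * q.factorial : ℝ) * (x ^ p * y ^ b * spinSphHarmPoly a b p x y) =
      (-1) ^ a * (x ^ a * y ^ p) *
        (b.factorial * (derivative^[a] (X ^ p * (1 - X) ^ q : ℝ[X])).eval (x ^ 2)) := by
  rw [eval_iterate_derivative_X_pow_mul_one_sub_X_pow h,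
    pow_mul_pow_mul_spinSphHarmPoly_eq_sum h, show 1 - x ^ 2 = y ^ 2 by linarith]
  ring

open Polynomial in
theorem spinSphHarmPoly_mul {a b p q a' b' p' q' : ℕ} (h : a + b = p + q)
    (h' : a' + b' = p' + q') (hap : a + p' = a' + p) (hbp : b + p' = b' + p) {x y : ℝ}
    (hx : 0 < x) (hy : 0 < y) (hxy : x ^ 2 + y ^ 2 = 1) :
    spinSphHarmPoly a b p x y * spinSphHarmPoly a' b' p' x y =
      (-1) ^ (a + p') * (b.factorial * a'.factorial /
        (p.factorial * q.factorial * (p'.factorial * q'.factorial))) *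
        (derivative^[a] (X ^ p * (1 - X) ^ q : ℝ[X]) *
          derivative^[b'] (X ^ q' * (1 - X) ^ p' : ℝ[X])).eval (x ^ 2) := by
  have e₁ := pow_mul_pow_mul_spinSphHarmPoly h hxy
  have e₂ := pow_mul_pow_mul_spinSphHarmPoly (a := b') (b := a') (p := q') (q := p')
    (by omega) hxy
  have hx' : x ^ p * x ^ q' = x ^ a * x ^ b' := by
    rw [← pow_add, ← pow_add]; congr 1; omega
  have hy' : y ^ b * y ^ a' = y ^ p * y ^ q' := by
    rw [← pow_add, ← pow_add]; congr 1; omega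
  have hs : (-1 : ℝ) ^ (p' + b') * (-1) ^ b' = (-1) ^ p' := by
    rw [← pow_add, show p' + b' + b' = p' + 2 * b' by omega, pow_add, pow_mul]; simp
  rw [spinSphHarmPoly_swap h', eval_mul]
  have hne : x ^ a * x ^ b' * (y ^ p * y ^ q') ≠ 0 := by positivity
  field_simp
  apply mul_left_cancel₀ hne
  rw [pow_add (-1 : ℝ) a, ← hs]
  generalize (derivative^[a] (X ^ p * (1 - X) ^ q : ℝ[X])).eval (x ^ 2) = u at *
  generalize (derivative^[b'] (X ^ q' * (1 - X) ^ p' : ℝ[X])).eval (x ^ 2) = v at *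
  generalize spinSphHarmPoly a b p x y = S at *
  generalize spinSphHarmPoly b' a' q' x y = S' at *
  have e := congrArg₂ (· * ·) e₁ e₂
  linear_combination (-1) ^ (p' + b') * e - (p.factorial * q.factorial * p'.factorial *
    q'.factorial * S * S' * (-1) ^ (p' + b')) * (hx' * (y ^ b * y ^ a') + hy' * (x ^ a * x ^ b'))

open Polynomial in
theorem integral_iterate_derivative_X_pow_mul_one_sub_X_pow_mul {a b p q p' q' : ℕ}
    (hab : a + b = p + q') (hpq : p + q' = q + p') :
    ∫ t in (0 : ℝ)..1, (derivative^[a] (X ^ p * (1 - X) ^ q : ℝ[X]) *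
        derivative^[b] (X ^ q' * (1 - X) ^ p' : ℝ[X])).eval t =
      if p = p' ∧ q = q' then
        (-1) ^ (b + q) * ((p.factorial * q.factorial : ℝ) / (p + q + 1)) else 0 := by
  simp only [eval_mul]
  rcases lt_or_ge (p' + q') (p + q) with hlt | hge
  · rw [if_neg (by omega)]
    simp only [mul_comm (eval _ (derivative^[a] _))]
    rw [integral_iterate_derivative_mul b a
      (fun i j hij => eval_iterate_derivative_mul_eq_zero (X_sub_C_zero_pow_dvd_X_pow_mul _ _)
        (X_sub_C_zero_pow_dvd_X_pow_mul _ _) (by omega))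
      (fun i j hij => eval_iterate_derivative_mul_eq_zero
        (X_sub_C_one_pow_dvd_mul_one_sub_X_pow _ _)
        (X_sub_C_one_pow_dvd_mul_one_sub_X_pow _ _) (by omega)),
      iterate_derivative_X_pow_mul_one_sub_X_pow_eq_zero (by omega)]
    simp
  · rw [integral_iterate_derivative_mul a b
      (fun i j hij => eval_iterate_derivative_mul_eq_zero (X_sub_C_zero_pow_dvd_X_pow_mul _ _)
        (X_sub_C_zero_pow_dvd_X_pow_mul _ _) (by omega))
      (fun i j hij => eval_iterate_derivative_mul_eq_zero
        (X_sub_C_one_pow_dvd_mul_one_sub_X_pow _ _)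
        (X_sub_C_one_pow_dvd_mul_one_sub_X_pow _ _) (by omega))]
    split_ifs with heq
    · obtain ⟨rfl, rfl⟩ := heq
      simp only [hab, eval_iterate_derivative_add_X_pow_mul_one_sub_X_pow, eval_mul, eval_pow,
        eval_X, eval_sub, eval_one, intervalIntegral.integral_const_mul,
        integral_pow_mul_one_sub_pow]
      rw [Nat.add_comm q p, Nat.factorial_succ, pow_add]
      push_cast
      field_simp
    · rw [iterate_derivative_X_pow_mul_one_sub_X_pow_eq_zero (by omega)]
      simp

open Polynomial in
theorem integral_spinSphHarmPoly_mul {a b p q a' b' p' q' : ℕ} (h : a + b = p + q)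
    (h' : a' + b' = p' + q') (hap : a + p' = a' + p) (hbp : b + p' = b' + p) :
    ∫ θ in (0 : ℝ)..π, spinSphHarmPoly a b p (Real.cos (θ / 2)) (Real.sin (θ / 2)) *
        spinSphHarmPoly a' b' p' (Real.cos (θ / 2)) (Real.sin (θ / 2)) * Real.sin θ =
      if p = p' ∧ q = q' then
        2 * ((a.factorial : ℝ) * b.factorial / (p.factorial * q.factorial * (p + q + 1))) else 0 := by
  have hcongr : ∀ θ ∈ Set.Ioo 0 π,
      spinSphHarmPoly a b p (Real.cos (θ / 2)) (Real.sin (θ / 2)) *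
        spinSphHarmPoly a' b' p' (Real.cos (θ / 2)) (Real.sin (θ / 2)) * Real.sin θ =
      (-1) ^ (a + p') * (b.factorial * a'.factorial /
        (p.factorial * q.factorial * (p'.factorial * q'.factorial))) *
        ((derivative^[a] (X ^ p * (1 - X) ^ q : ℝ[X]) *
          derivative^[b'] (X ^ q' * (1 - X) ^ p' : ℝ[X])).eval (Real.cos (θ / 2) ^ 2) *
            Real.sin θ) := by
    intro θ hθ
    rw [spinSphHarmPoly_mul h h' hap hbp
      (Real.cos_pos_of_mem_Ioo ⟨by linarith [hθ.1, hθ.2], by linarith [hθ.2]⟩)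
      (Real.sin_pos_of_pos_of_lt_pi (by linarith [hθ.1]) (by linarith [hθ.1, hθ.2]))
      (Real.cos_sq_add_sin_sq _), mul_assoc]
  rw [intervalIntegral.integral_congr_Ioo_of_le Real.pi_pos.le hcongr, intervalIntegral.integral_const_mul,
    integral_eval_cos_half_sq_mul_sin,
    integral_iterate_derivative_X_pow_mul_one_sub_X_pow_mul (by omega) (by omega)]
  split_ifs with heq
  · obtain ⟨rfl, rfl⟩ := heq
    obtain rfl : a = a' := by omega
    obtain rfl : b = b' := by omega
    have hs : (-1 : ℝ) ^ (a + p) * (-1) ^ (b + q) = 1 := by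
      rw [← pow_add, show a + p + (b + q) = 2 * (p + q) by omega, pow_mul]; simp
    field_simp
    linear_combination hs
  · simp

/-- **Orthonormality of the spin-weighted spherical harmonics:**
`∫ Y_{s,lm} conj(Y_{s,l'm'}) dΩ = δ_{ll'} δ_{mm'}`.
Taking `s = 0`, the ordinary spherical harmonics are orthonormal. -/
theorem spinSphHarm_orthonormal
    (s l l' m m' : ℤ) (hl : |s| ≤ l) (hl' : |s| ≤ l') (hm : |m| ≤ l) (hm' : |m'| ≤ l') :
    sphereIntegral (fun θ φ => spinSphHarm s l m θ φ * (starRingEnd ℂ) (spinSphHarm s l' m' θ φ)) =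
      if l = l' ∧ m = m' then 1 else 0 := by
  obtain ⟨hs₁, hs₂⟩ := abs_le.mp hl
  obtain ⟨hs₁', hs₂'⟩ := abs_le.mp hl'
  obtain ⟨hm₁, hm₂⟩ := abs_le.mp hm
  obtain ⟨hm₁', hm₂'⟩ := abs_le.mp hm'
  obtain ⟨a, ha⟩ := Int.eq_ofNat_of_zero_le (show 0 ≤ l - s by omega)
  obtain ⟨b, hb⟩ := Int.eq_ofNat_of_zero_le (show 0 ≤ l + s by omega)
  obtain ⟨p, hp⟩ := Int.eq_ofNat_of_zero_le (show 0 ≤ l - m by omega)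
  obtain ⟨q, hq⟩ := Int.eq_ofNat_of_zero_le (show 0 ≤ l + m by omega)
  obtain ⟨a', ha'⟩ := Int.eq_ofNat_of_zero_le (show 0 ≤ l' - s by omega)
  obtain ⟨b', hb'⟩ := Int.eq_ofNat_of_zero_le (show 0 ≤ l' + s by omega)
  obtain ⟨p', hp'⟩ := Int.eq_ofNat_of_zero_le (show 0 ≤ l' - m' by omega)
  obtain ⟨q', hq'⟩ := Int.eq_ofNat_of_zero_le (show 0 ≤ l' + m' by omega)
  set N : ℝ := √((a + b + 1) / (4 * π) * (q.factorial * p.factorial) /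
    (b.factorial * a.factorial)) with hN
  set N' : ℝ := √((a' + b' + 1) / (4 * π) * (q'.factorial * p'.factorial) /
    (b'.factorial * a'.factorial)) with hN'
  have hθ (φ : ℝ) : ∫ θ in (0 : ℝ)..π, spinSphHarm s l m θ φ *
        (starRingEnd ℂ) (spinSphHarm s l' m' θ φ) * ((Real.sin θ : ℝ) : ℂ) =
      cexp (I * m * φ) * (starRingEnd ℂ) (cexp (I * m' * φ)) * ((N * N' * ∫ θ in (0 : ℝ)..π,
        spinSphHarmPoly a b p (Real.cos (θ / 2)) (Real.sin (θ / 2)) *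
        spinSphHarmPoly a' b' p' (Real.cos (θ / 2)) (Real.sin (θ / 2)) * Real.sin θ : ℝ) : ℂ) := by
    rw [ofReal_mul, ← intervalIntegral.integral_ofReal, ← mul_assoc,
      ← intervalIntegral.integral_const_mul]
    refine intervalIntegral.integral_congr_Ioo_of_le Real.pi_pos.le fun θ hθ => ?_
    rw [spinSphHarm_eq ha hb hp hq hθ, spinSphHarm_eq ha' hb' hp' hq' hθ, map_mul, conj_ofReal,
      ← hN, ← hN']
    push_cast
    ring
  rw [sphereIntegral]
  simp only [hθ]
  rw [intervalIntegral.integral_mul_const, integral_cexp_mul_conj]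
  by_cases hmm : m = m'
  · subst hmm
    rw [integral_spinSphHarmPoly_mul (q := q) (q' := q') (by omega) (by omega) (by omega)
      (by omega), if_pos rfl]
    by_cases hll : l = l'
    · subst hll
      obtain rfl : a = a' := by omega
      obtain rfl : b = b' := by omega
      obtain rfl : p = p' := by omega
      obtain rfl : q = q' := by omega
      have habpq : (p + q : ℝ) = a + b := by
        have : p + q = a + b := by omega
        exact_mod_cast this
      rw [if_pos ⟨rfl, rfl⟩, if_pos ⟨rfl, rfl⟩, hN', ← hN, hN, habpq,
        Real.mul_self_sqrt (by positivity)]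
      norm_cast
      field_simp
      push_cast
      ring
    · rw [if_neg (by omega), if_neg (by tauto)]
      simp
  · rw [if_neg hmm, if_neg (by tauto), zero_mul]
end
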